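/- Let k≥3 be an integer, let G and G' be two (≤6)-hemimorphic digraphs on the same vertex set, and let C∈D_{G,G'} be a difference class. Then G[C] and G'[C] are (≤k)-hypomorphic if and only if C_dual(G[C]) ≥ k+1. -/

import Mathlib

universe u v

/-- A digraph: an irreflexive binary relation on a vertex type. -/
structure Dgraph (V : Type u) where
  Arc : V → V → Prop
  irrefl : ∀ x, ¬ Arc x x

namespace Dgraph

variable {V : Type u} {W : Type v}

/-- The dual digraph. -/
def dual (G : Dgraph V) : Dgraph V :=
  ⟨fun x y => G.Arc y x, fun x h => G.irrefl x h⟩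

/-- Subdigraph induced by a set of vertices. -/
def ind (G : Dgraph V) (X : Set V) : Dgraph X :=
  ⟨fun x y => G.Arc x y, fun x h => G.irrefl x h⟩

/-- Isomorphism of digraphs. -/
def Iso (G : Dgraph V) (G' : Dgraph W) : Prop :=
  ∃ e : V ≃ W, ∀ x y, G.Arc x y ↔ G'.Arc (e x) (e y)

/-- `G` and `G'` are hemimorphic: `G'` is isomorphic to `G` or to its dual. -/
def Hemi (G : Dgraph V) (G' : Dgraph W) : Prop :=
  Iso G G' ∨ Iso G.dual G'

/-- Self-dual digraph. -/
def SelfDual (G : Dgraph V) : Prop := Iso G G.dual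

/-- `{x,y}` is a directed pair. -/
def Dir (G : Dgraph V) (x y : V) : Prop :=
  (G.Arc x y ∧ ¬ G.Arc y x) ∨ (G.Arc y x ∧ ¬ G.Arc x y)

/-- `{x,y}` is a neutral pair (full or void). -/
def Neutral (G : Dgraph V) (x y : V) : Prop :=
  x ≠ y ∧ ¬ G.Dir x y

/-- Interval of a digraph. -/
def IsInterval (G : Dgraph V) (I : Set V) : Prop :=
  ∀ x ∉ I,
    (∀ y ∈ I, G.Arc x y ∧ ¬ G.Arc y x) ∨ (∀ y ∈ I, G.Arc y x ∧ ¬ G.Arc x y) ∨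
    (∀ y ∈ I, G.Arc x y ∧ G.Arc y x) ∨ (∀ y ∈ I, ¬ G.Arc x y ∧ ¬ G.Arc y x)

/-- The arc-connectivity equivalence relation. -/
def ACRel (G : Dgraph V) : V → V → Prop := Relation.ReflTransGen G.Dir

/-- Arc-connected components. -/
def IsACComponent (G : Dgraph V) (D : Set V) : Prop :=
  ∃ x, D = {y | G.ACRel x y}

/-- Arc-connected digraph (at most one arc-connected component). -/
def ArcConnected (G : Dgraph V) : Prop := ∀ x y, G.ACRel x y

/-- Tournament. -/
def IsTournament (G : Dgraph V) : Prop := ∀ x y, x ≠ y → G.Dir x y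

/-- Chain (transitive tournament). -/
def IsChainD (G : Dgraph V) : Prop :=
  G.IsTournament ∧ ∀ x y z, G.Arc x y → G.Arc y z → G.Arc x z

/-- Dgraph from a relation, with forced irreflexivity. -/
def ofRel (r : V → V → Prop) : Dgraph V := ⟨fun x y => x ≠ y ∧ r x y, fun x h => h.1 rfl⟩

/-- The model flag. -/
def flagD : Dgraph (Fin 3) :=
  ofRel (fun x y => (x = 0 ∧ y = 1) ∨ (x = 1 ∧ y = 2) ∨ (x = 2 ∧ y = 1))

/-- First model peak. -/
def peakD1 : Dgraph (Fin 3) :=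
  ofRel (fun x y => (x = 0 ∧ y = 1) ∨ (x = 0 ∧ y = 2) ∨ (x = 1 ∧ y = 2) ∨ (x = 2 ∧ y = 1))

/-- Second model peak. -/
def peakD2 : Dgraph (Fin 3) :=
  ofRel (fun x y => (x = 0 ∧ y = 1) ∨ (x = 0 ∧ y = 2))

/-- The model diamond. -/
def diamondD : Dgraph (Fin 4) :=
  ofRel (fun x y => (x = 0 ∧ y = 1) ∨ (x = 0 ∧ y = 2) ∨ (x = 0 ∧ y = 3) ∨
    (x = 1 ∧ y = 2) ∨ (x = 2 ∧ y = 3) ∨ (x = 3 ∧ y = 1))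

/-- A flag is a digraph hemimorphic to the model flag. -/
def IsFlag (G : Dgraph V) : Prop := Hemi G flagD

/-- A peak is a digraph hemimorphic to one of the two model peaks. -/
def IsPeak (G : Dgraph V) : Prop := Hemi G peakD1 ∨ Hemi G peakD2

/-- A diamond is a digraph hemimorphic to the model diamond. -/
def IsDiamond (G : Dgraph V) : Prop := Hemi G diamondD

/-- Prechain: embeds no peak, no diamond, no two adjacent neutral pairs. -/
def IsPrechain (G : Dgraph V) : Prop :=
  (∀ X : Set V, ¬ IsPeak (G.ind X)) ∧ (∀ X : Set V, ¬ IsDiamond (G.ind X)) ∧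
  ¬ ∃ x y z : V, y ≠ z ∧ G.Neutral x y ∧ G.Neutral x z

/-- Proper prechain: a prechain which is not a chain. -/
def ProperPrechain (G : Dgraph V) : Prop := G.IsPrechain ∧ ¬ G.IsChainD

/-- Diamond-free tournament. -/
def DiamondFreeTournament (G : Dgraph V) : Prop :=
  G.IsTournament ∧ ∀ X : Set V, ¬ IsDiamond (G.ind X)

/-- Non-tournament prechain. -/
def NonTournamentPrechain (G : Dgraph V) : Prop := G.IsPrechain ∧ ¬ G.IsTournament

/-- Model finite consecutivity on `n` vertices (`full` decides whether the
non-consecutive pairs are all full or all void). -/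
def consecFin (n : ℕ) (full : Bool) : Dgraph (Fin n) :=
  ofRel (fun i j => i.1 + 1 = j.1 ∨ (full = true ∧ (i.1 + 1 < j.1 ∨ j.1 + 1 < i.1)))

/-- Model consecutivity of type ω. -/
def consecNat (full : Bool) : Dgraph ℕ :=
  ofRel (fun i j => i + 1 = j ∨ (full = true ∧ (i + 1 < j ∨ j + 1 < i)))

/-- Model consecutivity of type ω*+ω. -/
def consecInt (full : Bool) : Dgraph ℤ :=
  ofRel (fun i j => i + 1 = j ∨ (full = true ∧ (i + 1 < j ∨ j + 1 < i)))

/-- One-end infinite consecutivity (obtained from ω or ω*). -/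
def OneEndInfiniteConsecutivity (G : Dgraph V) : Prop :=
  ∃ full, Iso G (consecNat full) ∨ Iso G (consecNat full).dual

/-- Consecutivity. -/
def IsConsecutivity (G : Dgraph V) : Prop :=
  (∃ n, 3 ≤ n ∧ ∃ full, Iso G (consecFin n full)) ∨
  G.OneEndInfiniteConsecutivity ∨ (∃ full, Iso G (consecInt full))

/-- Model cycle on `n ≥ 3` vertices obtained from the finite consecutivity by
replacing the neutral pair `{0, n-1}` by the arc `(n-1, 0)`. -/
def cycleD (n : ℕ) (full : Bool) : Dgraph (Fin n) :=
  ofRel (fun i j => i.1 + 1 = j.1 ∨ (i.1 = n - 1 ∧ j.1 = 0) ∨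
    (full = true ∧ (i.1 + 1 < j.1 ∨ j.1 + 1 < i.1) ∧
      ¬ (i.1 = 0 ∧ j.1 = n - 1) ∧ ¬ (i.1 = n - 1 ∧ j.1 = 0)))

/-- Cycle. -/
def IsCycle (G : Dgraph V) : Prop := ∃ n, 3 ≤ n ∧ ∃ full, Iso G (cycleD n full)

/-- Near-chain: obtained from a chain by exchanging the directed pair formed
by its extremities. -/
def IsNearChain (G : Dgraph V) : Prop :=
  ∃ (H : Dgraph V) (m M : V), H.IsChainD ∧ m ≠ M ∧
    (∀ x, x ≠ m → H.Arc m x) ∧ (∀ x, x ≠ M → H.Arc x M) ∧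
    (∀ x y, G.Arc x y ↔ ((H.Arc x y ∧ ¬ (x = m ∧ y = M)) ∨ (x = M ∧ y = m)))

/-- `{k}`-hypomorphy. -/
def KHypo (k : ℕ) (G G' : Dgraph V) : Prop :=
  ∀ X : Set V, X.Finite → X.ncard = k → Iso (G.ind X) (G'.ind X)

/-- `(≤ k)`-hypomorphy. -/
def LeHypo (k : ℕ) (G G' : Dgraph V) : Prop :=
  ∀ j, 1 ≤ j → j ≤ k → KHypo j G G'

/-- `{k}`-hemimorphy. -/
def KHemi (k : ℕ) (G G' : Dgraph V) : Prop :=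
  ∀ X : Set V, X.Finite → X.ncard = k → Hemi (G.ind X) (G'.ind X)

/-- `(≤ k)`-hemimorphy. -/
def LeHemi (k : ℕ) (G G' : Dgraph V) : Prop :=
  ∀ j, 1 ≤ j → j ≤ k → KHemi j G G'

/-- `(≤ k)`-half-reconstructibility. -/
def HalfRecon (k : ℕ) (G : Dgraph V) : Prop :=
  ∀ G' : Dgraph V, LeHemi k G G' → Hemi G G'

/-- One step of the difference relation. -/
def DiffStep (G G' : Dgraph V) (x y : V) : Prop := G.Arc x y ↔ ¬ G'.Arc x y

/-- The difference relation `𝔇_{G,G'}`. -/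
def DiffRel (G G' : Dgraph V) (x y : V) : Prop :=
  x = y ∨ Relation.TransGen (DiffStep G G') x y

/-- Difference classes: `C ∈ D_{G,G'}`. -/
def DiffClass (G G' : Dgraph V) (C : Set V) : Prop :=
  ∃ x, C = {y | DiffRel G G' x y}

/-- The difference relation has at least two equivalence classes. -/
def AtLeastTwoDiffClasses (G G' : Dgraph V) : Prop :=
  ∃ C₁ C₂ : Set V, DiffClass G G' C₁ ∧ DiffClass G G' C₂ ∧ C₁ ≠ C₂

/-- `C_dual(G)`: the smallest cardinality of a finite set of vertices inducing a
non-self-dual subdigraph (`⊤` if there is none). -/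
noncomputable def Cdual (G : Dgraph V) : ℕ∞ :=
  sInf {n : ℕ∞ | ∃ X : Set V, X.Finite ∧ ¬ SelfDual (G.ind X) ∧ n = (X.ncard : ℕ∞)}

/-- The contracted digraph `G_I` (the vertex `none` plays the role of `I`). -/
def contract (G : Dgraph V) (I : Set V) : Dgraph (Option {x : V // x ∉ I}) where
  Arc := fun a b =>
    match a, b with
    | some x, some y => G.Arc x.1 y.1
    | some x, none => ∃ z ∈ I, G.Arc x.1 z
    | none, some y => ∃ z ∈ I, G.Arc z y.1
    | none, none => False
  irrefl := by
    rintro (_ | ⟨x, hx⟩)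
    · simp
    · exact G.irrefl x

/-- There is an isomorphism `f` from `G_I` onto `G'_I` with `f(I) = I`. -/
def ContractIsoFix (G G' : Dgraph V) (I : Set V) : Prop :=
  ∃ e : Option {x : V // x ∉ I} ≃ Option {x : V // x ∉ I},
    e none = none ∧ ∀ a b, (G.contract I).Arc a b ↔ (G'.contract I).Arc (e a) (e b)

/-- `D` is disjoint from every flag of `G`. -/
def FlagDisjoint (G : Dgraph V) (D : Set V) : Prop :=
  ∀ F : Set V, IsFlag (G.ind F) → D ∩ F = ∅

/-- `D` contains a vertex `a` of a flag `{a,b,c}` of `G` with `b, c ∉ D` and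
`{b,c}` the directed pair of the flag. -/
def FlagVertexCond (G : Dgraph V) (D : Set V) : Prop :=
  ∃ a ∈ D, ∃ b c : V, b ∉ D ∧ c ∉ D ∧ IsFlag (G.ind {a, b, c}) ∧ G.Dir b c

/-- Condition `C_∞`. -/
def CondCinf (G : Dgraph V) : Prop :=
  (∃ I : Set V, I.Infinite ∧ G.IsInterval I ∧ (G.ind I).IsChainD) ∨
  (∃ I J : Set V, I ≠ J ∧ G.IsInterval I ∧ G.IsInterval J ∧
     (G.ind I).OneEndInfiniteConsecutivity ∧ (G.ind J).OneEndInfiniteConsecutivity) ∨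
  (∃ I : Set V, G.IsInterval I ∧ (G.ind I).OneEndInfiniteConsecutivity ∧
     (∀ J : Set V, G.IsInterval J → (G.ind J).OneEndInfiniteConsecutivity → J = I) ∧
     ¬ ContractIsoFix G G.dual I)

/-- The kind of component occurring in conditions `K1` and `K2`. -/
def K12Kind (G : Dgraph V) (D : Set V) : Prop :=
  DiamondFreeTournament (G.ind D) ∨ (NonTournamentPrechain (G.ind D) ∧ G.FlagDisjoint D)

/-- Condition `K1`. -/
def CondK1 (G : Dgraph V) : Prop :=
  G.Cdual = 3 ∧ ∃ D₁ D₂ : Set V, D₁ ≠ D₂ ∧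
    (G.IsACComponent D₁ ∧ ¬ SelfDual (G.ind D₁) ∧ G.IsInterval D₁ ∧ G.K12Kind D₁) ∧
    (G.IsACComponent D₂ ∧ ¬ SelfDual (G.ind D₂) ∧ G.IsInterval D₂ ∧ G.K12Kind D₂)

/-- Condition `K2`. -/
def CondK2 (G : Dgraph V) : Prop :=
  G.Cdual = 3 ∧ ∃ D₀ : Set V, G.IsACComponent D₀ ∧ ¬ SelfDual (G.ind D₀) ∧
    (∀ D, G.IsACComponent D → ¬ SelfDual (G.ind D) → D = D₀) ∧
    G.K12Kind D₀ ∧ ¬ ContractIsoFix G G.dual D₀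

/-- Condition `K3`. -/
def CondK3 (G : Dgraph V) : Prop :=
  G.Cdual = 4 ∧ ∃ D₁ D₂ : Set V, D₁ ≠ D₂ ∧
    (G.IsACComponent D₁ ∧ ¬ SelfDual (G.ind D₁) ∧ G.IsInterval D₁) ∧
    (G.IsACComponent D₂ ∧ ¬ SelfDual (G.ind D₂) ∧ G.IsInterval D₂)

/-- Condition `K4`. -/
def CondK4 (G : Dgraph V) : Prop :=
  G.Cdual = 5 ∧ ∃ D₁ D₂ : Set V, D₁ ≠ D₂ ∧
    (G.IsACComponent D₁ ∧ ¬ SelfDual (G.ind D₁) ∧ G.IsInterval D₁ ∧ IsPrechain (G.ind D₁)) ∧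
    (G.IsACComponent D₂ ∧ ¬ SelfDual (G.ind D₂) ∧ G.IsInterval D₂ ∧ IsPrechain (G.ind D₂))

/-- Condition `K5`. -/
def CondK5 (G : Dgraph V) : Prop :=
  G.Cdual = 6 ∧ ∃ D₁ D₂ : Set V, D₁ ≠ D₂ ∧
    (G.IsACComponent D₁ ∧ ¬ SelfDual (G.ind D₁) ∧ G.IsInterval D₁ ∧
      DiamondFreeTournament (G.ind D₁)) ∧
    (G.IsACComponent D₂ ∧ ¬ SelfDual (G.ind D₂) ∧ G.IsInterval D₂ ∧
      DiamondFreeTournament (G.ind D₂))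

/-- The kind of interval occurring in conditions `L1` and `L2`. -/
def L12Int (G : Dgraph V) (I : Set V) : Prop :=
  G.IsInterval I ∧ DiamondFreeTournament (G.ind I) ∧ ¬ SelfDual (G.ind I) ∧
    ¬ G.IsACComponent I

/-- Condition `L1`. -/
def CondL1 (G : Dgraph V) : Prop :=
  ∃ I₁ I₂ : Set V, I₁ ≠ I₂ ∧ G.L12Int I₁ ∧ G.L12Int I₂

/-- Condition `L2`. -/
def CondL2 (G : Dgraph V) : Prop :=
  ∃ I₀ : Set V, G.L12Int I₀ ∧ (∀ I, G.L12Int I → I = I₀) ∧ ¬ ContractIsoFix G G.dual I₀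

/-- Condition `L3`. -/
def CondL3 (G : Dgraph V) : Prop :=
  G.Cdual = 3 ∧ ∃ D₁ D₂ : Set V, D₁ ≠ D₂ ∧
    (G.IsACComponent D₁ ∧ ¬ SelfDual (G.ind D₁) ∧ G.IsInterval D₁) ∧
    (G.IsACComponent D₂ ∧ ¬ SelfDual (G.ind D₂) ∧ G.IsInterval D₂) ∧
    ((G.FlagDisjoint D₁ ∧ Cdual (G.ind D₁) = 4 ∧ G.FlagDisjoint D₂ ∧ Cdual (G.ind D₂) = 4) ∨
     (NonTournamentPrechain (G.ind D₁) ∧ G.FlagVertexCond D₁ ∧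
      NonTournamentPrechain (G.ind D₂) ∧ G.FlagVertexCond D₂))

/-- Condition `L4`. -/
def CondL4 (G : Dgraph V) : Prop :=
  G.Cdual = 3 ∧ ∃ D₀ : Set V, G.IsACComponent D₀ ∧ ¬ SelfDual (G.ind D₀) ∧
    (∀ D, G.IsACComponent D → ¬ SelfDual (G.ind D) → D = D₀) ∧
    G.IsInterval D₀ ∧
    ((G.FlagDisjoint D₀ ∧ Cdual (G.ind D₀) = 4) ∨
     (NonTournamentPrechain (G.ind D₀) ∧ G.FlagVertexCond D₀)) ∧
    ¬ ContractIsoFix G G.dual D₀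

end Dgraph

namespace Dgraph
variable {V : Type u}

/-- Local constraints on a relation `A` and a set `R` of reversed pairs, as imposed by
`(≤3)`-hypomorphy. -/
structure Rev (A R : V → V → Prop) : Prop where
  irr : ∀ x, ¬ A x x
  symm : ∀ x y, R x y → R y x
  dir : ∀ x y, R x y → ¬ (A x y ↔ A y x)
  one : ∀ x y z, z ≠ x → z ≠ y → R x y → ¬ R x z → ¬ R y z →
    (A z x ↔ A z y) ∧ (A x z ↔ A y z)
  two : ∀ x y z, R x y → R y z → ¬ R x z → ¬ (A x z ↔ A z x) →
    (A y x ↔ A y z) ∧ (A x y ↔ A z y)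
  path : ∀ x y z, x ≠ z → R x y → R y z → (A x z ↔ A z x) →
    (A x y ↔ A y z) ∧ (A y x ↔ A z y)

/-- No vertex is the source of two arcs whose ends form a neutral pair. -/
def PeakFree (A : V → V → Prop) : Prop :=
  ∀ a b c, b ≠ c → A a b → ¬ A b a → A a c → ¬ A c a → (A b c ↔ A c b) → False

/-- No directed pair followed by a full pair whose ends form a void pair. -/
def FlagFree (A : V → V → Prop) : Prop :=
  ∀ a b c, ¬ (A a b ↔ A b a) → a ≠ c → A b c → A c b → ¬ A a c → ¬ A c a → False

/-- `a` is joined to `b` by a walk of length `n`. -/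
def Walk (R : V → V → Prop) (a : V) : ℕ → V → Prop
  | 0, b => b = a
  | n + 1, b => ∃ y, R b y ∧ Walk R a n y

theorem exists_walk {R : V → V → Prop} {a b : V} (h : Relation.ReflTransGen R b a) :
    ∃ n, Walk R a n b := by
  induction h using Relation.ReflTransGen.head_induction_on with
  | refl => exact ⟨0, rfl⟩
  | head h _ ih =>
    obtain ⟨n, hn⟩ := ih
    exact ⟨n + 1, _, h, hn⟩

namespace Rev
variable {A R : V → V → Prop}

theorem flip (h : Rev A R) : Rev (fun x y => A y x) R where
  irr := h.irr
  symm := h.symm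
  dir x y hR := by have := h.dir x y hR; tauto
  one x y z h1 h2 h3 h4 h5 := by have := h.one x y z h1 h2 h3 h4 h5; tauto
  two x y z h1 h2 h3 h4 := by have := h.two x y z h1 h2 h3 (by tauto); tauto
  path x y z h1 h2 h3 h4 := by have := h.path x y z h1 h2 h3 (by tauto); tauto

theorem peakFree (h : Rev A R) (conn : ∀ x y, Relation.ReflTransGen R x y) : PeakFree A := by
  intro a
  obtain ⟨irr, symm, dir, one, two, path⟩ := h
  have noR : ∀ b c, b ≠ c → A a b → ¬ A b a → A a c → ¬ A c a → (A b c ↔ A c b) →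
      ¬ R a b ∧ ¬ R a c ∧ ¬ R b c := by
    intro b c hbc hab hba hac hca hn
    grind
  have nbr : ∀ b c y, b ≠ c → A a b → ¬ A b a → A a c → ¬ A c a → (A b c ↔ A c b) →
      R b y → ¬ R y a := by
    intro b c y hbc hab hba hac hca hn hby hya
    obtain ⟨n1, n2, n3⟩ := noR b c hbc hab hba hac hca hn
    have hyc : c ≠ y := by rintro rfl; exact n2 (symm _ _ hya)
    by_cases hyc' : R y c
    · have d := dir y b (symm _ _ hby)
      have p := path b y c hbc hby hyc' hn
      have t1 := two b y a
      have t2 := two c y a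
      clear noR one two path conn
      grind
    · have o1 := one y b c hyc hbc.symm (symm _ _ hby) hyc' n3
      have o2 := one y a c hyc (by rintro rfl; exact irr _ hac) hya hyc' n2
      clear noR one two path conn
      grind
  have key : ∀ n b c, Walk R a n b → b ≠ c → A a b → ¬ A b a → A a c → ¬ A c a →
      (A b c ↔ A c b) → False := by
    intro n
    induction n using Nat.strong_induction_on with
    | _ n ih =>
    intro b c hw hbc hab hba hac hca hn
    obtain ⟨n1, n2, n3⟩ := noR b c hbc hab hba hac hca hn
    match n with
    | 0 => exact irr a (by simpa [Walk] using hw ▸ hab)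
    | 1 =>
      obtain ⟨y, hy, hya⟩ := hw
      obtain rfl : y = a := hya
      exact n1 (symm _ _ hy)
    | n + 2 =>
      obtain ⟨y, hy, y', hy', hw⟩ := hw
      have hya := nbr b c y hbc hab hba hac hca hn hy
      have nab : a ≠ b := by rintro rfl; exact irr _ hab
      have nba : ¬ R b a := fun hr => n1 (symm _ _ hr)
      have e1 : A a y ∧ ¬ A y a := by
        have := one b y a nab (by rintro rfl; exact nba hy) hy nba hya
        tauto
      by_cases hyc : R y c
      · have hb : ¬ R y' b := fun hb =>
          ih (n + 1) (by omega) b c ⟨y', symm _ _ hb, hw⟩ hbc hab hba hac hca hn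
        have hc : ¬ R y' c := fun hc =>
          ih (n + 1) (by omega) c b ⟨y', symm _ _ hc, hw⟩ hbc.symm hac hca hab hba hn.symm
        have ny'b : y' ≠ b := by
          rintro rfl; exact ih n (by omega) y' c hw hbc hab hba hac hca hn
        have ny'c : y' ≠ c := by
          rintro rfl
          exact ih n (by omega) y' b hw hbc.symm hac hca hab hba hn.symm
        have hya' : y' ≠ a := by rintro rfl; exact hya hy'
        by_cases hy'a : R y' a
        · have := one y' a b ny'b.symm (by grind) hy'a (by grind) (by grind)
          have := one y' a c ny'c.symm (by grind) hy'a (by grind) (by grind)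
          have p1 := path b y c hbc hy hyc hn
          have p2 := two y' y b (by grind) (by grind) (by grind) (by grind)
          have p3 := two y' y c (by grind) (by grind) (by grind) (by grind)
          have := dir _ _ hy
          grind
        · have e2 : A a y' ∧ ¬ A y' a := by
            have := one y y' a (by grind) hya'.symm hy' (by grind) (by grind)
            grind
          have p1 := path b y c hbc hy hyc hn
          have d1 := dir _ _ hy
          have d2 := dir _ _ hy'
          have q1 : ¬ (A b y' ↔ A y' b) := fun hq =>
            ih n (by omega) y' b hw ny'b e2.1 e2.2 hab hba hq.symm
          have q2 : ¬ (A c y' ↔ A y' c) := fun hq =>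
            ih n (by omega) y' c hw ny'c e2.1 e2.2 hac hca hq.symm
          have t1 := two b y y' hy hy' (by grind) q1
          have t2 := two c y y' (by grind) hy' (by grind) q2
          grind
      · have := one b y c hbc.symm (by rintro rfl; exact n3 hy) hy n3 hyc
        exact ih (n + 1) (by omega) y c ⟨y', hy', hw⟩ (by rintro rfl; exact n3 hy)
          e1.1 e1.2 hac hca (by grind)
  intro b c
  obtain ⟨n, hn⟩ := exists_walk (conn b a)
  exact key n b c hn

theorem flagFree (h : Rev A R) (conn : ∀ x y, Relation.ReflTransGen R x y)
    (hq : ∀ a b c x, ¬ (A a b ↔ A b a) → a ≠ c → A b c → A c b → ¬ A a c → ¬ A c a →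
      ¬ R a b → R x a → R x b → R x c → False) : FlagFree A := by
  intro a b
  obtain ⟨irr, symm, dir, one, two, path⟩ := h
  have hw := conn a b
  induction hw using Relation.ReflTransGen.head_induction_on with
  | refl => tauto
  | @head a x hax _ ih =>
    intro c hd hne hbc hcb hac hca
    have nbc : ¬ R b c := by grind
    have nac : ¬ R a c := by grind
    have nca : ¬ R c a := by grind
    have ncb : ¬ R c b := by grind
    have nab : ¬ R a b := by
      intro hr
      have := one a b c hne.symm (by grind) hr nac nbc
      grind
    have nba : ¬ R b a := by grind
    have hxa := symm _ _ hax
    have q := hq a b c x hd hne hbc hcb hac hca nab hxa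
    have hxb : x ≠ b := by grind
    have hxc : x ≠ c := by grind
    have hab : a ≠ b := by grind
    have hcb' : c ≠ b := by grind
    by_cases r1 : R x b
    · by_cases r2 : R x c
      · exact q r1 r2
      · have := one x a c hxc.symm hne.symm hxa r2 nac
        have := one x b c hxc.symm hcb' r1 r2 nbc
        grind
    · by_cases r2 : R x c
      · have := one x a b hxb.symm hab.symm hxa r1 nab
        have := one x c b hxb.symm hcb'.symm r2 r1 ncb
        grind
      · have := one x a b hxb.symm hab.symm hxa r1 nab
        have := one x a c hxc.symm hne.symm hxa r2 nac
        exact ih c (by grind) hxc hbc hcb (by grind) (by grind)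

theorem compl (h : Rev A R) (hp : PeakFree A) (hp' : PeakFree (fun x y => A y x))
    (hf : FlagFree A) : Rev A (fun x y => ¬ (A x y ↔ A y x) ∧ ¬ R x y) := by
  obtain ⟨irr, symm, dir, one, two, path⟩ := h
  refine ⟨irr, fun x y hxy => ⟨fun e => hxy.1 e.symm, fun hr => hxy.2 (symm _ _ hr)⟩,
    fun x y hxy => hxy.1, ?_, ?_, ?_⟩
  · intro x y z hzx hzy hxy hxz hyz
    have s1 := symm x z
    have s2 := symm y z
    have s3 := symm y x
    have s4 := symm z x
    have s5 := symm z y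
    have hne : x ≠ y := by rintro rfl; exact hxy.1 Iff.rfl
    have d1 := dir x z
    have d2 := dir y z
    have t := two x z y
    have o1 := one x z y hne.symm hzy.symm
    have o2 := one y z x hne hzx.symm
    have p1 := hp x y z hzy.symm
    have p2 := hp' x y z hzy.symm
    have p3 := hp y x z hzx.symm
    have p4 := hp' y x z hzx.symm
    have f1 := hf x y z
    have f2 := hf y x z
    clear one two path
    grind
  · intro x y z hxy hyz hxz hd
    have hR : R x z := by tauto
    exact one x z y (by rintro rfl; exact hxy.1 Iff.rfl) (by rintro rfl; exact hyz.1 Iff.rfl)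
      hR hxy.2 (fun hr => hyz.2 (symm _ _ hr))
  · intro x y z hne hxy hyz hn
    have p1 := hp y x z hne
    have p2 := hp' y x z hne
    clear one two path
    grind

end Rev

/-- `a → b → c → a` is a directed `3`-cycle. -/
def Cyc (A : V → V → Prop) (a b c : V) : Prop :=
  (A a b ∧ ¬ A b a) ∧ (A b c ∧ ¬ A c b) ∧ (A c a ∧ ¬ A a c)

theorem Cyc.rotate {A : V → V → Prop} {a b c : V} (h : Cyc A a b c) : Cyc A b c a :=
  ⟨h.2.1, h.2.2, h.1⟩

theorem Cyc.flip {A : V → V → Prop} {a b c : V} (h : Cyc A a b c) :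
    Cyc (fun x y => A y x) c b a :=
  ⟨h.2.1, h.1, h.2.2⟩

namespace Rev
variable {A R : V → V → Prop}

theorem cyc_mono (h : Rev A R) {a b c : V} (hc : Cyc A a b c) (hR : R a b) : R b c := by
  have d0 := h.irr a
  have d0' := h.irr b
  obtain ⟨h1, h2, h3⟩ := hc
  have hac : c ≠ a := by rintro rfl; exact d0 h3.1
  have hcb : c ≠ b := by rintro rfl; exact d0' h2.1
  have o := h.one a b c hac hcb hR
  have s1 := h.symm c a
  have s2 := h.symm a b
  have s3 := h.symm a c
  have s4 := h.symm c b
  have t := h.two b a c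
  clear h
  grind

theorem cyc_replace (h : Rev A R) {a b c x : V} (hc : Cyc A a b c) (hR : ¬ R a b)
    (hx : R x a) :
    (¬ R x b ∧ Cyc A x b c) ∨
      (R x b ∧ R x c ∧ (A x a ↔ A x b) ∧ (A x a ↔ A x c)) := by
  have n1 : ¬ R c a := fun hr => hR (h.cyc_mono hc.rotate.rotate hr)
  have n2 : ¬ R b c := fun hr => n1 (h.cyc_mono hc.rotate hr)
  obtain ⟨h1, h2, h3⟩ := hc
  have hba : b ≠ a := by rintro rfl; exact h.irr _ h1.1
  have hac : c ≠ a := by rintro rfl; exact h.irr _ h3.1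
  have hcb : c ≠ b := by rintro rfl; exact h.irr _ h2.1
  have s1 := h.symm a b
  have s2 := h.symm b a
  have s3 := h.symm a c
  have s4 := h.symm c b
  have s5 := h.symm a x
  have s6 := h.symm b x
  have s7 := h.symm c x
  have s8 := h.symm x a hx
  have s9 := h.symm x b
  have s10 := h.symm x c
  have hxb : b ≠ x := by rintro rfl; exact hR (s2 hx)
  have hxc : c ≠ x := by rintro rfl; exact n1 hx
  have o1 := h.one x a b hxb hba
  have o2 := h.one x a c hxc hac
  have o3 := h.one x b c hxc hcb
  have o4 := h.one x c b hxb hcb.symm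
  have t1 := h.two a x b
  have t2 := h.two a x c
  have t3 := h.two b x c
  unfold Cyc
  clear h
  grind

theorem cyc_not_conn (h : Rev A R)
    (hq : ∀ a b c x, Cyc A a b c → R x a → R x b → R x c → (A x a ↔ A x b) →
      (A x a ↔ A x c) → ¬ R a b → False) {a b : V} (hw : Relation.ReflTransGen R a b) :
    ∀ c, Cyc A a b c → R a b := by
  induction hw using Relation.ReflTransGen.head_induction_on with
  | refl => exact fun c hc => absurd hc.1.1 (h.irr _)
  | @head a x hax _ ih =>
    intro c hc
    by_contra hR
    have hx := h.symm _ _ hax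
    rcases h.cyc_replace hc hR hx with h1 | ⟨h1, h2, h3, h4⟩
    · exact h1.1 (ih c h1.2)
    · exact hq a b c x hc hx h1 h2 h3 h4 hR

end Rev

/-- No vertex is joined uniformly by reversed pairs to a `3`-cycle. -/
def NoConedCycle (A R : V → V → Prop) : Prop :=
  ∀ a b c x, Cyc A a b c → R x a → R x b → R x c → (A x a ↔ A x b) → (A x a ↔ A x c) → False

theorem NoConedCycle.flip {A R : V → V → Prop} (hq : NoConedCycle A R)
    (h : Rev A R) : NoConedCycle (fun x y => A y x) R := by
  intro a b c x hc ha hb hc' h1 h2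
  have d1 := h.dir _ _ ha
  have d2 := h.dir _ _ hb
  have d3 := h.dir _ _ hc'
  exact hq c b a x hc.flip hc' hb ha (by tauto) (by tauto)

namespace Rev
variable {A R : V → V → Prop}

theorem cone_step (h : Rev A R) {a b c z y : V} (hc : Cyc A a b c) (rab : R a b)
    (rbc : R b c) (rca : R c a) (hza : A z a ∧ ¬ A a z) (hzb : A z b ∧ ¬ A b z)
    (hzc : A z c ∧ ¬ A c z) (n1 : ¬ R z a) (n2 : ¬ R z b) (n3 : ¬ R z c) (hzy : R z y)
    (hya : R y a) : R y b ∧ R y c := by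
  have nb : b ≠ y := by rintro rfl; exact n2 hzy
  have nc : c ≠ y := by rintro rfl; exact n3 hzy
  have nb' : b ≠ z := by rintro rfl; exact hzb.2 hzb.1
  have nc' : c ≠ z := by rintro rfl; exact hzc.2 hzc.1
  have rac := h.symm _ _ rca
  have rcb := h.symm _ _ rbc
  have sb := h.symm b y
  have sc := h.symm c y
  have u1 := h.two z y a hzy hya n1 (fun e => hza.2 (e.1 hza.1))
  have d1 := h.dir _ _ hzy
  have d2 := h.dir _ _ hya
  have t1 := h.two y a b hya rab
  have t2 := h.two y a c hya rac
  have p1 := h.path y a b nb.symm hya rab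
  have p2 := h.path y a c nc.symm hya rac
  obtain ⟨c1, c2, c3⟩ := hc
  by_cases rb : R y b
  · by_cases rc : R y c
    · exact ⟨rb, rc⟩
    · have t3 := h.two y b c rb rbc
      have p3 := h.path y b c nc.symm rb rbc
      have o := h.one z y c nc' nc hzy n3 rc
      have u2 := h.two z y b hzy rb n2 (fun e => hzb.2 (e.1 hzb.1))
      clear h
      exfalso
      grind
  · by_cases rc : R y c
    · have t3 := h.two y c b rc rcb
      have p3 := h.path y c b nb.symm rc rcb
      have o := h.one z y b nb' nb hzy n2 rb
      have u2 := h.two z y c hzy rc n3 (fun e => hzc.2 (e.1 hzc.1))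
      clear h
      exfalso
      grind
    · have o := h.one b c y nb.symm nc.symm rbc (fun hr => rb (sb hr)) (fun hr => rc (sc hr))
      clear h
      exfalso
      grind

theorem no_diamond (h : Rev A R) (conn : ∀ x y, Relation.ReflTransGen R x y)
    (hq : NoConedCycle A R) {a b c : V} (hc : Cyc A a b c) (z : V) :
    ¬ ((A z a ∧ ¬ A a z) ∧ (A z b ∧ ¬ A b z) ∧ (A z c ∧ ¬ A c z)) := by
  have mono : ∀ a b c, Cyc A a b c → R a b := fun a b c hc =>
    h.cyc_not_conn (fun a b c x h1 h2 h3 h4 h5 h6 _ => hq a b c x h1 h2 h3 h4 h5 h6)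
      (conn a b) c hc
  have rab := mono _ _ _ hc
  have rbc := mono _ _ _ hc.rotate
  have rca := mono _ _ _ hc.rotate.rotate
  have hba : b ≠ a := by rintro rfl; exact h.irr _ hc.1.1
  have hac : c ≠ a := by rintro rfl; exact h.irr _ hc.2.2.1
  have hcb : c ≠ b := by rintro rfl; exact h.irr _ hc.2.1.1
  have hw := conn z a
  have noR : ∀ z, (A z a ∧ ¬ A a z) ∧ (A z b ∧ ¬ A b z) ∧ (A z c ∧ ¬ A c z) →
      ¬ R z a ∧ ¬ R z b ∧ ¬ R z c := by
    intro z hz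
    have q := hq a b c z hc
    have t1 := h.two z a b
    have t2 := h.two z b c
    have t3 := h.two z c a
    obtain ⟨h1, h2, h3⟩ := hc
    clear h hq mono conn
    grind
  induction hw using Relation.ReflTransGen.head_induction_on with
  | refl => exact fun hz => hz.1.2 hz.1.1
  | @head z y hzy _ ih =>
    intro hz
    obtain ⟨n1, n2, n3⟩ := noR z hz
    have hyz := h.symm _ _ hzy
    obtain ⟨ha, hb, hc'⟩ := hz
    have ka := h.cone_step hc rab rbc rca ha hb hc' n1 n2 n3 hzy
    have kb := h.cone_step hc.rotate rbc rca rab hb hc' ha n2 n3 n1 hzy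
    have kc := h.cone_step hc.rotate.rotate rca rab rbc hc' ha hb n3 n1 n2 hzy
    by_cases hy : R y a ∨ R y b ∨ R y c
    · have hall : R y a ∧ R y b ∧ R y c := by
        rcases hy with hy | hy | hy
        · exact ⟨hy, ka hy⟩
        · exact ⟨(kb hy).2, hy, (kb hy).1⟩
        · exact ⟨(kc hy).1, (kc hy).2, hy⟩
      obtain ⟨ra, rb, rc⟩ := hall
      have u1 := (h.two z y a hzy ra n1 (fun e => ha.2 (e.1 ha.1))).2
      have u2 := (h.two z y b hzy rb n2 (fun e => hb.2 (e.1 hb.1))).2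
      have u3 := (h.two z y c hzy rc n3 (fun e => hc'.2 (e.1 hc'.1))).2
      have v1 := (h.two z y a hzy ra n1 (fun e => ha.2 (e.1 ha.1))).1
      have v2 := (h.two z y b hzy rb n2 (fun e => hb.2 (e.1 hb.1))).1
      have v3 := (h.two z y c hzy rc n3 (fun e => hc'.2 (e.1 hc'.1))).1
      exact hq a b c y hc ra rb rc (v1.symm.trans v2) (v1.symm.trans v3)
    · have hya : a ≠ y := by rintro rfl; exact n1 hzy
      have hyb : b ≠ y := by rintro rfl; exact n2 hzy
      have hyc : c ≠ y := by rintro rfl; exact n3 hzy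
      have hza : a ≠ z := by rintro rfl; exact ha.2 ha.1
      have hzb : b ≠ z := by rintro rfl; exact hb.2 hb.1
      have hzc : c ≠ z := by rintro rfl; exact hc'.2 hc'.1
      have o1 := h.one z y a hza hya hzy n1 (fun e => hy (Or.inl e))
      have o2 := h.one z y b hzb hyb hzy n2 (fun e => hy (Or.inr (Or.inl e)))
      have o3 := h.one z y c hzc hyc hzy n3 (fun e => hy (Or.inr (Or.inr e)))
      exact ih ⟨⟨o1.2.1 ha.1, fun e => ha.2 (o1.1.2 e)⟩, ⟨o2.2.1 hb.1, fun e => hb.2 (o2.1.2 e)⟩,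
        o3.2.1 hc'.1, fun e => hc'.2 (o3.1.2 e)⟩

end Rev

/-- The classes of the unreversed directed pairs. -/
def Kept (A R : V → V → Prop) (x y : V) : Prop := ¬ (A x y ↔ A y x) ∧ ¬ R x y

namespace Rev
variable {A R : V → V → Prop}

theorem no_kept_cycle (h : Rev A R) (hk : Rev A (Kept A R))
    (conn : ∀ x y, Relation.ReflTransGen R x y) (hq : NoConedCycle A R) {a b c : V}
    (hc : Cyc A a b c) : ¬ Relation.ReflTransGen (Kept A R) a b := by
  intro hw
  have mono : ∀ a b c, Cyc A a b c → R a b := fun a b c hc =>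
    h.cyc_not_conn (fun a b c x h1 h2 h3 h4 h5 h6 _ => hq a b c x h1 h2 h3 h4 h5 h6)
      (conn a b) c hc
  refine absurd (mono a b c hc) (hk.cyc_not_conn ?_ hw c hc).2
  intro a b c x hc ha hb hc' h1 h2 _
  have d1 := ha.1
  have d2 := hb.1
  have d3 := hc'.1
  have e1 := h.no_diamond conn hq hc x
  have e2 := h.flip.no_diamond conn (hq.flip h) hc.flip x
  tauto

theorem kept_path (h : Rev A R) (hk : Rev A (Kept A R)) (hp : PeakFree A)
    (hp' : PeakFree (fun x y => A y x)) (conn : ∀ x y, Relation.ReflTransGen R x y)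
    (u y v : V) (huv : u ≠ v) (huy : Kept A R u y) (hyv : Kept A R y v)
    (hn : A u v ↔ A v u) : False := by
  have hw := conn u y
  induction hw using Relation.ReflTransGen.head_induction_on with
  | refl => exact huy.1 Iff.rfl
  | @head u x hux _ ih =>
    have hxu := h.symm _ _ hux
    have hyu := hk.symm _ _ huy
    have hvy := hk.symm _ _ hyv
    have hny : u ≠ y := by rintro rfl; exact huy.1 Iff.rfl
    have hnv : v ≠ y := by rintro rfl; exact hyv.1 Iff.rfl
    have hxv : x ≠ v := by rintro rfl; exact h.dir _ _ hux hn
    have hxy : x ≠ y := by rintro rfl; exact huy.2 hux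
    have nuv : ¬ R u v := fun hr => h.dir _ _ hr hn
    have o1 := h.one x u y hxy.symm hny.symm hxu
    have o2 := h.one x u v hxv.symm huv.symm hxu
    have ruy := huy.2
    have rvy := hvy.2
    have ryu := hyu.2
    have ryv := hyv.2
    have duy := huy.1
    have dyv := hyv.1
    have rvu : ¬ R v u := fun hr => nuv (h.symm _ _ hr)
    by_cases r1 : R x y
    · by_cases r2 : R x v
      · have t1 := h.two u x y hux r1 ruy duy
        have t2 := h.two y x v (h.symm _ _ r1) r2 ryv dyv
        have p := hp x u v huv
        have p' := hp' x u v huv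
        have d := h.dir _ _ hux
        clear h hk hp hp' conn ih
        grind
      · have o3 := h.one x y v hxv.symm hnv r1 r2 ryv
        have o4 := o2 r2 nuv
        clear h hk hp hp' conn ih
        grind
    · by_cases r2 : R x v
      · have o3 := h.one x v y hxy.symm hnv.symm r2 r1 rvy
        have o4 := o1 r1 ruy
        have p := hp y u v huv
        have p' := hp' y u v huv
        clear h hk hp hp' conn ih
        grind
      · have o3 := o2 r2 nuv
        have o4 := o1 r1 ruy
        exact ih hxv ⟨fun e => duy (o4.2.symm.trans (e.trans o4.1)), r1⟩
          (o3.2.trans (hn.trans o3.1.symm))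

theorem kept_not_neutral (h : Rev A R) (hk : Rev A (Kept A R)) (hp : PeakFree A)
    (hp' : PeakFree (fun x y => A y x)) (conn : ∀ x y, Relation.ReflTransGen R x y)
    {u v : V} (huv : u ≠ v) (hw : Relation.ReflTransGen (Kept A R) u v) :
    ¬ (A u v ↔ A v u) := by
  induction hw using Relation.ReflTransGen.head_induction_on with
  | refl => exact absurd rfl huv
  | @head u x hux _ ih =>
    intro hn
    have hxv : x ≠ v := by rintro rfl; exact hux.1 hn
    have hd := ih hxv
    refine h.kept_path hk hp hp' conn u x v huv hux ⟨hd, fun hr => ?_⟩ hn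
    have d := hux.1
    have p := hp x u v huv
    have p' := hp' x u v huv
    have o := h.one x v u (by rintro rfl; exact d Iff.rfl) huv hr
      (fun hr => hux.2 (h.symm _ _ hr)) (fun hr => h.dir _ _ hr hn.symm)
    clear h hk hp hp' conn ih
    grind

end Rev
end Dgraph

namespace Dgraph

variable {V : Type u} {W : Type v}

theorem Iso.symm {G : Dgraph V} {G' : Dgraph W} (h : Iso G G') : Iso G' G := by
  obtain ⟨e, he⟩ := h
  exact ⟨e.symm, fun x y => by rw [he]; simp⟩

theorem Iso.trans {U : Type*} {G : Dgraph V} {G' : Dgraph W} {G'' : Dgraph U}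
    (h : Iso G G') (h' : Iso G' G'') : Iso G G'' := by
  obtain ⟨e, he⟩ := h
  obtain ⟨e', he'⟩ := h'
  exact ⟨e.trans e', fun x y => by rw [he, he']; rfl⟩

theorem Iso.dual {G : Dgraph V} {G' : Dgraph W} (h : Iso G G') : Iso G.dual G'.dual := by
  obtain ⟨e, he⟩ := h
  exact ⟨e, fun x y => he y x⟩

theorem Iso.exists_map {H H' : Dgraph V} {X : Set V} (h : Iso (H.ind X) (H'.ind X)) :
    ∃ f : V → V, (∀ x ∈ X, f x ∈ X) ∧ (∀ x ∈ X, ∀ y ∈ X, f x = f y → x = y) ∧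
      (∀ y ∈ X, ∃ x ∈ X, f x = y) ∧
      ∀ x ∈ X, ∀ y ∈ X, (H.Arc x y ↔ H'.Arc (f x) (f y)) := by
  classical
  obtain ⟨e, he⟩ := h
  refine ⟨fun x => if hx : x ∈ X then e ⟨x, hx⟩ else x, ?_, ?_, ?_, ?_⟩
  · intro x hx
    simp [hx]
  · intro x hx y hy h
    simp only [hx, hy, dif_pos] at h
    simpa using e.injective (Subtype.ext h)
  · intro y hy
    refine ⟨e.symm ⟨y, hy⟩, (e.symm ⟨y, hy⟩).2, by simp⟩
  · intro x hx y hy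
    simp only [hx, hy, dif_pos]
    exact he ⟨x, hx⟩ ⟨y, hy⟩

theorem of_not_diffStep {H H' : Dgraph V} {x y : V} (h : ¬ DiffStep H H' x y) :
    H.Arc x y ↔ H'.Arc x y := by
  unfold DiffStep at h
  tauto

theorem KHypo.symm {k : ℕ} {H H' : Dgraph V} (h : KHypo k H H') : KHypo k H' H :=
  fun X hX hk => (h X hX hk).symm

theorem KHypo.pair {H H' : Dgraph V} (h : KHypo 2 H H') (x y : V) :
    ((H.Arc x y ↔ H'.Arc x y) ∧ (H.Arc y x ↔ H'.Arc y x)) ∨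
    ((H.Arc x y ↔ H'.Arc y x) ∧ (H.Arc y x ↔ H'.Arc x y)) := by
  by_cases hxy : x = y
  · subst hxy
    simp [H.irrefl, H'.irrefl]
  · obtain ⟨f, h1, h2, -, h3⟩ := (h {x, y} (Set.toFinite _) (Set.ncard_pair hxy)).exists_map
    have a1 := h1 x (by simp)
    have a2 := h1 y (by simp)
    have a3 := h2 x (by simp) y (by simp)
    have a4 := h3 x (by simp) y (by simp)
    have a5 := h3 y (by simp) x (by simp)
    simp only [Set.mem_insert_iff, Set.mem_singleton_iff] at a1 a2
    rcases a1 with a1 | a1 <;> rcases a2 with a2 | a2 <;> rw [a1, a2] at a3 a4 a5 <;> tauto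

/-- `A` and `B` agree on a triple up to relabelling its elements. -/
def Match (A B : V → V → Prop) (x y z x' y' z' : V) : Prop :=
  (A x y ↔ B x' y') ∧ (A y x ↔ B y' x') ∧ (A x z ↔ B x' z') ∧ (A z x ↔ B z' x') ∧
    (A y z ↔ B y' z') ∧ (A z y ↔ B z' y')

theorem KHypo.triple {H H' : Dgraph V} (h : KHypo 3 H H') {x y z : V} (hxy : x ≠ y)
    (hxz : x ≠ z) (hyz : y ≠ z) :
    Match H.Arc H'.Arc x y z x y z ∨ Match H.Arc H'.Arc x y z x z y ∨
    Match H.Arc H'.Arc x y z y x z ∨ Match H.Arc H'.Arc x y z y z x ∨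
    Match H.Arc H'.Arc x y z z x y ∨ Match H.Arc H'.Arc x y z z y x := by
  obtain ⟨f, h1, h2, -, h3⟩ := (h {x, y, z} (Set.toFinite _)
    (Set.ncard_eq_three.2 ⟨x, y, z, hxy, hxz, hyz, rfl⟩)).exists_map
  have m1 : x ∈ ({x, y, z} : Set V) := by simp
  have m2 : y ∈ ({x, y, z} : Set V) := by simp
  have m3 : z ∈ ({x, y, z} : Set V) := by simp
  have hm : Match H.Arc H'.Arc x y z (f x) (f y) (f z) :=
    ⟨h3 _ m1 _ m2, h3 _ m2 _ m1, h3 _ m1 _ m3, h3 _ m3 _ m1, h3 _ m2 _ m3, h3 _ m3 _ m2⟩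
  have i1 := fun e => hxy (h2 x m1 y m2 e)
  have i2 := fun e => hxz (h2 x m1 z m3 e)
  have i3 := fun e => hyz (h2 y m2 z m3 e)
  have a1 := h1 x m1
  have a2 := h1 y m2
  have a3 := h1 z m3
  clear h1 h2 h3
  simp only [Set.mem_insert_iff, Set.mem_singleton_iff] at a1 a2 a3
  rcases a1 with a1 | a1 | a1 <;> rcases a2 with a2 | a2 | a2 <;>
    rcases a3 with a3 | a3 | a3 <;> rw [a1, a2, a3] at hm <;> simp_all

theorem rev_of_hypo {H H' : Dgraph V} (h2 : KHypo 2 H H') (h3 : KHypo 3 H H') :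
    Rev H.Arc (DiffStep H H') := by
  have symm : ∀ x y, DiffStep H H' x y → DiffStep H H' y x := by
    intro x y
    have p := h2.pair x y
    unfold DiffStep
    tauto
  have dir : ∀ x y, DiffStep H H' x y → ¬ (H.Arc x y ↔ H.Arc y x) := by
    intro x y
    have p := h2.pair x y
    unfold DiffStep
    tauto
  have ne : ∀ x y, DiffStep H H' x y → x ≠ y := by
    rintro x y h rfl
    exact dir _ _ h Iff.rfl
  refine ⟨H.irrefl, symm, dir, ?_, ?_, ?_⟩
  · intro x y z hzx hzy hxy hxz hyz
    have p1 := h2.pair x y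
    have p2 := h2.pair x z
    have p3 := h2.pair y z
    have t := h3.triple (ne _ _ hxy) hzx.symm hzy.symm
    have d := dir _ _ hxy
    clear h2 h3 symm dir ne
    unfold DiffStep Match at *
    rcases t with t | t | t | t | t | t <;> grind
  · intro x y z hxy hyz hxz hd
    have p1 := h2.pair x y
    have p2 := h2.pair x z
    have p3 := h2.pair y z
    have t := h3.triple (ne _ _ hxy) (by rintro rfl; exact hd Iff.rfl) (ne _ _ hyz)
    have d := dir _ _ hxy
    have d' := dir _ _ hyz
    clear h2 h3 symm dir ne
    unfold DiffStep Match at *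
    rcases t with t | t | t | t | t | t <;> grind
  · intro x y z hne hxy hyz hn
    have p1 := h2.pair x y
    have p2 := h2.pair x z
    have p3 := h2.pair y z
    have t := h3.triple (ne _ _ hxy) hne (ne _ _ hyz)
    have d := dir _ _ hxy
    have d' := dir _ _ hyz
    clear h2 h3 symm dir ne
    unfold DiffStep Match at *
    rcases t with t | t | t | t | t | t <;> grind

theorem flag_cone {H H' : Dgraph V} (h2 : KHypo 2 H H') (h4 : KHemi 4 H H') {a b c x : V}
    (hab : ¬ (H.Arc a b ↔ H.Arc b a)) (hac : a ≠ c) (h1 : H.Arc b c) (h1' : H.Arc c b)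
    (h0 : ¬ H.Arc a c) (h0' : ¬ H.Arc c a) (nab : ¬ DiffStep H H' a b)
    (ha : DiffStep H H' x a) (hb : DiffStep H H' x b) (hc : DiffStep H H' x c) : False := by
  have p1 := h2.pair x a
  have p2 := h2.pair x b
  have p3 := h2.pair x c
  have p4 := h2.pair a b
  have p5 := h2.pair a c
  have p6 := h2.pair b c
  have n1 : x ≠ a := by rintro rfl; simp [DiffStep, H.irrefl, H'.irrefl] at ha
  have n2 : x ≠ b := by rintro rfl; simp [DiffStep, H.irrefl, H'.irrefl] at hb
  have n3 : x ≠ c := by rintro rfl; simp [DiffStep, H.irrefl, H'.irrefl] at hc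
  have n4 : a ≠ b := by rintro rfl; exact hab Iff.rfl
  have n6 : b ≠ c := by rintro rfl; exact H.irrefl _ h1
  have hcard : ({x, a, b, c} : Set V).ncard = 4 := by
    rw [Set.ncard_insert_of_notMem (by simp [n1, n2, n3]),
      Set.ncard_eq_three.2 ⟨a, b, c, n4, hac, n6, rfl⟩]
  have m1 : x ∈ ({x, a, b, c} : Set V) := by simp
  have m2 : a ∈ ({x, a, b, c} : Set V) := by simp
  have m3 : b ∈ ({x, a, b, c} : Set V) := by simp
  have m4 : c ∈ ({x, a, b, c} : Set V) := by simp
  have i1 := H'.irrefl x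
  have i2 := H'.irrefl a
  have i3 := H'.irrefl b
  have i4 := H'.irrefl c
  unfold DiffStep at *
  have fix : ∀ f : V → V, (∀ y ∈ ({x, a, b, c} : Set V), f y ∈ ({x, a, b, c} : Set V)) →
      (∀ y ∈ ({x, a, b, c} : Set V), ∀ z ∈ ({x, a, b, c} : Set V), f y = f z → y = z) →
      H'.Arc (f b) (f c) → H'.Arc (f c) (f b) → ¬ H'.Arc (f a) (f c) →
      ¬ H'.Arc (f c) (f a) → f c = c ∧ f a = a ∧ f b = b ∧ f x = x := by
    intro f f1 f2 e1 e2 e3 e4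
    have q1 := f1 x m1
    have q2 := f1 a m2
    have q3 := f1 b m3
    have q4 := f1 c m4
    have j1 := f2 x m1 a m2
    have j2 := f2 x m1 b m3
    have j3 := f2 x m1 c m4
    have j4 := f2 a m2 b m3
    have j5 := f2 a m2 c m4
    have j6 := f2 b m3 c m4
    clear f1 f2 m1 m2 m3 m4 hcard h2 h4
    simp only [Set.mem_insert_iff, Set.mem_singleton_iff] at q1 q2 q3 q4
    have hfc : f c = c := by
      rcases q4 with q4 | q4 | q4 | q4
      · exfalso
        rcases q2 with q2 | q2 | q2 | q2 <;> grind
      · exfalso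
        rcases q3 with q3 | q3 | q3 | q3 <;> grind
      · exfalso
        rcases q2 with q2 | q2 | q2 | q2 <;> grind
      · exact q4
    have hfa : f a = a := by
      rcases q2 with q2 | q2 | q2 | q2 <;> grind
    have hfb : f b = b := by
      rcases q3 with q3 | q3 | q3 | q3 <;> grind
    refine ⟨hfc, hfa, hfb, ?_⟩
    rcases q1 with q1 | q1 | q1 | q1 <;> grind
  rcases h4 _ (Set.toFinite _) hcard with hi | hi
  · obtain ⟨f, f1, f2, -, f3⟩ := hi.exists_map
    obtain ⟨e1, e2, e3, e4⟩ := fix f f1 f2 ((f3 _ m3 _ m4).1 h1) ((f3 _ m4 _ m3).1 h1')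
      (fun e => h0 ((f3 _ m2 _ m4).2 e)) (fun e => h0' ((f3 _ m4 _ m2).2 e))
    have := f3 _ m1 _ m2
    rw [e2, e4] at this
    rw [this] at ha
    exact iff_not_self ha
  · have hi' : Iso (H.dual.ind {x, a, b, c}) (H'.ind {x, a, b, c}) := hi
    obtain ⟨f, f1, f2, -, f3⟩ := hi'.exists_map
    obtain ⟨e1, e2, e3, e4⟩ := fix f f1 f2 ((f3 _ m3 _ m4).1 h1') ((f3 _ m4 _ m3).1 h1)
      (fun e => h0' ((f3 _ m2 _ m4).2 e)) (fun e => h0 ((f3 _ m4 _ m2).2 e))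
    have := f3 _ m2 _ m3
    rw [e2, e3] at this
    exact hab ((of_not_diffStep nab).trans this.symm)

theorem noConedCycle {H H' : Dgraph V} (h : Rev H.Arc (DiffStep H H')) (h2 : KHypo 2 H H')
    (h4 : KHypo 4 H H') : NoConedCycle H.Arc (DiffStep H H') := by
  have aux : ∀ p q r s : Prop, ¬ (p ↔ q) → ¬ (r ↔ s) → (p ↔ r) → (q ↔ s) := by
    intro p q r s
    tauto
  intro a b c x hc ha hb hc' u1 u2
  have p1 := h2.pair x a
  have p2 := h2.pair x b
  have p3 := h2.pair x c
  have p4 := h2.pair a b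
  have p5 := h2.pair a c
  have p6 := h2.pair b c
  have d1 := h.dir _ _ ha
  have r1 := h.cyc_mono hc
  have r2 := h.cyc_mono hc.rotate
  have r3 := h.cyc_mono hc.rotate.rotate
  obtain ⟨c1, c2, c3⟩ := hc
  have n1 : x ≠ a := by rintro rfl; exact h.dir _ _ ha Iff.rfl
  have n2 : x ≠ b := by rintro rfl; exact h.dir _ _ hb Iff.rfl
  have n3 : x ≠ c := by rintro rfl; exact h.dir _ _ hc' Iff.rfl
  have n4 : a ≠ b := by rintro rfl; exact c1.2 c1.1
  have n5 : a ≠ c := by rintro rfl; exact c3.2 c3.1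
  have n6 : b ≠ c := by rintro rfl; exact c2.2 c2.1
  have hcard : ({x, a, b, c} : Set V).ncard = 4 := by
    rw [Set.ncard_insert_of_notMem (by simp [n1, n2, n3]),
      Set.ncard_eq_three.2 ⟨a, b, c, n4, n5, n6, rfl⟩]
  have m1 : x ∈ ({x, a, b, c} : Set V) := by simp
  have m2 : a ∈ ({x, a, b, c} : Set V) := by simp
  have m3 : b ∈ ({x, a, b, c} : Set V) := by simp
  have m4 : c ∈ ({x, a, b, c} : Set V) := by simp
  obtain ⟨f, f1, f2, f4, f3⟩ := (h4 _ (Set.toFinite _) hcard).exists_map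
  have key : ∀ w ∈ ({x, a, b, c} : Set V), w ≠ f x →
      (H'.Arc (f x) w ↔ H.Arc x a) ∧ (H'.Arc w (f x) ↔ H.Arc a x) := by
    intro w hw hne
    obtain ⟨v, hv, rfl⟩ := f4 w hw
    rw [← f3 x m1 v hv, ← f3 v hv x m1]
    have d2 := h.dir _ _ hb
    have d3 := h.dir _ _ hc'
    simp only [Set.mem_insert_iff, Set.mem_singleton_iff] at hv
    rcases hv with rfl | rfl | rfl | rfl
    · exact absurd rfl hne
    · exact ⟨Iff.rfl, Iff.rfl⟩
    · exact ⟨u1.symm, (aux _ _ _ _ d1 d2 u1).symm⟩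
    · exact ⟨u2.symm, (aux _ _ _ _ d1 d3 u2).symm⟩
  have q := f1 x m1
  have k1 := key x m1
  have k2 := key a m2
  have k3 := key b m3
  have k4 := key c m4
  clear f1 f2 f3 f4 m1 m2 m3 m4 hcard h2 h4 key h
  unfold DiffStep at *
  simp only [Set.mem_insert_iff, Set.mem_singleton_iff] at q
  rcases q with q | q | q | q <;> rw [q] at k1 k2 k3 k4 <;> grind

end Dgraph

namespace Dgraph

theorem exists_equiv_of_strictTotalOrder {α : Type*} [Finite α] (r s : α → α → Prop)
    [IsStrictTotalOrder α r] [IsStrictTotalOrder α s] :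
    ∃ e : α ≃ α, ∀ x y, r x y ↔ s (e x) (e y) := by
  classical
  cases nonempty_fintype α
  have e₁ : ∃ e : Fin (Fintype.card α) ≃ α, ∀ i j, i < j ↔ r (e i) (e j) := by
    let _ := linearOrderOfSTO r
    exact ⟨(monoEquivOfFin α rfl).toEquiv, fun i j => (monoEquivOfFin α rfl).lt_iff_lt.symm⟩
  have e₂ : ∃ e : Fin (Fintype.card α) ≃ α, ∀ i j, i < j ↔ s (e i) (e j) := by
    let _ := linearOrderOfSTO s
    exact ⟨(monoEquivOfFin α rfl).toEquiv, fun i j => (monoEquivOfFin α rfl).lt_iff_lt.symm⟩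
  obtain ⟨e₁, h₁⟩ := e₁
  obtain ⟨e₂, h₂⟩ := e₂
  exact ⟨e₁.symm.trans e₂, fun x y => by simp [← h₂, h₁]⟩

/-- `r` is a strict total order on each class of the equivalence relation `E`. -/
def TotalOnClasses {α : Type*} (E : Setoid α) (r : α → α → Prop) : Prop :=
  (∀ x, ¬ r x x) ∧ (∀ x y, E x y → x ≠ y → r x y ∨ r y x) ∧
    ∀ x y z, E x y → E y z → r x y → r y z → r x z

theorem TotalOnClasses.isStrictTotalOrder {α : Type*} {E : Setoid α} {r : α → α → Prop}
    (h : TotalOnClasses E r) (q : Quotient E) :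
    IsStrictTotalOrder {x // Quotient.mk E x = q} fun x y => r x.1 y.1 := by
  have hE : ∀ x y : {x // Quotient.mk E x = q}, E x.1 y.1 :=
    fun x y => Quotient.exact (x.2.trans y.2.symm)
  have tri : ∀ x y : {x // Quotient.mk E x = q}, ¬ r x.1 y.1 → ¬ r y.1 x.1 → x = y := by
    intro x y h1 h2
    by_contra hne
    rcases h.2.1 _ _ (hE x y) (fun e => hne (Subtype.ext e)) with h3 | h3
    exacts [h1 h3, h2 h3]
  exact
    { trichotomous := tri
      irrefl := fun x => h.1 _
      trans := fun x y z h1 h2 => h.2.2 _ _ _ (hE x y) (hE y z) h1 h2 }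

theorem exists_equiv_of_classes {α : Type*} [Finite α] (E : Setoid α) {r s : α → α → Prop}
    (hr : TotalOnClasses E r) (hs : TotalOnClasses E s)
    (hrs : ∀ x y, ¬ E x y → (r x y ↔ s x y))
    (hmod : ∀ x y z, E x y → ¬ E x z → (s x z ↔ s y z) ∧ (s z x ↔ s z y)) :
    ∃ e : α ≃ α, ∀ x y, r x y ↔ s (e x) (e y) := by
  have hf : ∀ q : Quotient E, ∃ e : {x // Quotient.mk E x = q} ≃ {x // Quotient.mk E x = q},
      ∀ x y, r x.1 y.1 ↔ s (e x).1 (e y).1 := by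
    intro q
    have := hr.isStrictTotalOrder q
    have := hs.isStrictTotalOrder q
    exact exists_equiv_of_strictTotalOrder (fun x y : {x // Quotient.mk E x = q} => r x.1 y.1)
      (fun x y => s x.1 y.1)
  choose f hf using hf
  let e : α ≃ α := ((Equiv.sigmaFiberEquiv (Quotient.mk E)).symm.trans
    (Equiv.sigmaCongrRight f)).trans (Equiv.sigmaFiberEquiv (Quotient.mk E))
  have he : ∀ q (x : {x // Quotient.mk E x = q}), e x.1 = (f q x).1 := by
    rintro q ⟨x, rfl⟩
    rfl
  have hE : ∀ x, E x (e x) := fun x =>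
    Quotient.exact ((f _ ⟨x, rfl⟩).2.symm.trans (by rw [← he]))
  refine ⟨e, fun x y => ?_⟩
  by_cases hxy : E x y
  · have := hf _ ⟨x, Quotient.sound hxy⟩ ⟨y, rfl⟩
    rwa [← he, ← he] at this
  · have h1 : ¬ E y (e x) := fun h => hxy (E.trans' (hE x) (E.symm' h))
    rw [hrs x y hxy, (hmod _ _ _ (hE x) hxy).1, (hmod _ _ _ (hE y) h1).2]

end Dgraph

namespace Dgraph

variable {V : Type u}

theorem TotalOnClasses.of_no_cycle {α : Type*} {E : Setoid α} {A : α → α → Prop}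
    (irr : ∀ x, ¬ A x x) (dir : ∀ x y, E x y → x ≠ y → ¬ (A x y ↔ A y x))
    (cyc : ∀ x y z, E x y → ¬ Cyc A x y z) : TotalOnClasses E A := by
  refine ⟨irr, fun x y h hne => ?_, fun x y z hxy hyz h1 h2 => ?_⟩
  · have := dir x y h hne
    tauto
  · have nxy : x ≠ y := by rintro rfl; exact irr _ h1
    have nyz : y ≠ z := by rintro rfl; exact irr _ h2
    have d1 := dir x y hxy nxy
    have d2 := dir y z hyz nyz
    have nxz : x ≠ z := by rintro rfl; exact d1 (iff_of_true h1 h2)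
    have d3 := dir x z (E.trans' hxy hyz) nxz
    have c := cyc x y z hxy
    unfold Cyc at c
    tauto

theorem diffStep_comm (H H' : Dgraph V) : DiffStep H' H = DiffStep H H' := by
  funext x y
  unfold DiffStep
  exact propext iff_not_comm

theorem kept_comm {H H' : Dgraph V} (h2 : KHypo 2 H H') :
    Kept H'.Arc (DiffStep H' H) = Kept H.Arc (DiffStep H H') := by
  funext x y
  rw [diffStep_comm]
  have p := h2.pair x y
  unfold Kept
  apply propext
  have : (H'.Arc x y ↔ H'.Arc y x) ↔ (H.Arc x y ↔ H.Arc y x) := by tauto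
  rw [this]

theorem kept_structure {H H' : Dgraph V} (h2 : KHypo 2 H H') (h3 : KHypo 3 H H')
    (h4 : KHypo 4 H H') (conn : ∀ x y, Relation.ReflTransGen (DiffStep H H') x y) :
    Rev H.Arc (Kept H.Arc (DiffStep H H')) ∧
    (∀ x y, Relation.ReflTransGen (Kept H.Arc (DiffStep H H')) x y → x ≠ y →
      ¬ (H.Arc x y ↔ H.Arc y x)) ∧
    ∀ x y z, Relation.ReflTransGen (Kept H.Arc (DiffStep H H')) x y →
      ¬ Cyc H.Arc x y z := by
  have h := rev_of_hypo h2 h3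
  have hp := h.peakFree conn
  have hp' := h.flip.peakFree conn
  have hf := h.flagFree conn fun a b c x h1 h5 h6 h7 h8 h9 h10 h11 h12 h13 =>
    flag_cone h2 (fun X hX hc => Or.inl (h4 X hX hc)) h1 h5 h6 h7 h8 h9 h10 h11 h12 h13
  have hk : Rev H.Arc (Kept H.Arc (DiffStep H H')) := h.compl hp hp' hf
  exact ⟨hk, fun x y hxy hne => h.kept_not_neutral hk hp hp' conn hne hxy,
    fun x y z hxy hc => h.no_kept_cycle hk conn (noConedCycle h h2 h4) hc hxy⟩

/-- Two `(≤ 4)`-hypomorphic digraphs with a single difference class: each one is, on every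
finite set, isomorphic to the dual of the other. -/
theorem iso_dual_of_connected {H H' : Dgraph V} (h2 : KHypo 2 H H') (h3 : KHypo 3 H H')
    (h4 : KHypo 4 H H') (conn : ∀ x y, Relation.ReflTransGen (DiffStep H H') x y)
    (X : Set V) (hX : X.Finite) : Iso (H.dual.ind X) (H'.ind X) := by
  have : Finite X := hX
  obtain ⟨k1, k2, k3⟩ := kept_structure h2 h3 h4 conn
  obtain ⟨l1, l2, l3⟩ := kept_structure h2.symm h3.symm h4.symm
    (by rw [diffStep_comm]; exact conn)
  rw [kept_comm h2] at l1 l2 l3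
  set K := Kept H.Arc (DiffStep H H') with hK
  have symm : ∀ {x y}, Relation.ReflTransGen K x y → Relation.ReflTransGen K y x :=
    have : Std.Symm K := ⟨k1.symm⟩
    fun h => Relation.ReflTransGen.stdSymm.symm _ _ h
  let E : Setoid X :=
    { r := fun x y => Relation.ReflTransGen K x.1 y.1
      iseqv := ⟨fun _ => .refl, fun h => symm h, fun h h' => h.trans h'⟩ }
  have across : ∀ x y, ¬ Relation.ReflTransGen K x y → (H.Arc y x ↔ H'.Arc x y) := by
    intro x y h
    have hn : ¬ K x y := fun e => h (.single e)
    have p := h2.pair x y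
    simp only [hK, Kept, DiffStep] at hn
    tauto
  have mod : ∀ x y z, Relation.ReflTransGen K x y → ¬ Relation.ReflTransGen K x z →
      (H'.Arc x z ↔ H'.Arc y z) ∧ (H'.Arc z x ↔ H'.Arc z y) := by
    intro x y z hxy hxz
    induction hxy with
    | refl => exact ⟨Iff.rfl, Iff.rfl⟩
    | @tail b c hb hbc ih =>
      have hc := hb.tail hbc
      obtain ⟨o1, o2⟩ := l1.one b c z (by rintro rfl; exact hxz hb)
        (by rintro rfl; exact hxz hc) hbc (fun e => hxz (hb.tail e)) (fun e => hxz (hc.tail e))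
      exact ⟨ih.1.trans o2, ih.2.trans o1⟩
  obtain ⟨e, he⟩ := exists_equiv_of_classes (α := X) E (r := fun x y => H.Arc y.1 x.1)
    (s := fun x y => H'.Arc x.1 y.1)
    (.of_no_cycle (fun x => H.irrefl x)
      (fun x y h hne h' => k2 _ _ h (fun e => hne (Subtype.ext e)) h'.symm)
      (fun x y z h hc => k3 y.1 x.1 z.1 (symm h) (Cyc.flip hc).rotate))
    (.of_no_cycle (fun x => H'.irrefl x)
      (fun x y h hne => l2 _ _ h (fun e => hne (Subtype.ext e)))
      (fun x y z h hc => l3 _ _ z.1 h hc))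
    (fun x y h => across x.1 y.1 h) (fun x y z => mod x.1 y.1 z.1)
  exact ⟨e, he⟩

end Dgraph

namespace Dgraph

variable {V : Type u}

theorem natCast_add_one_le_cdual_iff {H : Dgraph V} {k : ℕ} :
    (k : ℕ∞) + 1 ≤ Cdual H ↔ ∀ X : Set V, X.Finite → X.ncard ≤ k → SelfDual (H.ind X) := by
  unfold Cdual
  rw [le_sInf_iff]
  constructor
  · intro h X hX hk
    by_contra hs
    have := h _ ⟨X, hX, hs, rfl⟩
    have : k + 1 ≤ X.ncard := by exact_mod_cast this
    omega
  · rintro h _ ⟨X, hX, hs, rfl⟩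
    have : k + 1 ≤ X.ncard := by
      by_contra hlt
      exact hs (h X hX (by omega))
    exact_mod_cast this

theorem selfDual_of_involutive {H : Dgraph V} {X : Set V} (f : V → V)
    (hX : ∀ x ∈ X, f x ∈ X) (hf : ∀ x ∈ X, f (f x) = x)
    (h : ∀ x ∈ X, ∀ y ∈ X, H.Arc x y ↔ H.Arc (f y) (f x)) : SelfDual (H.ind X) :=
  ⟨⟨fun x => ⟨f x, hX x x.2⟩, fun x => ⟨f x, hX x x.2⟩, fun x => Subtype.ext (hf x x.2),
    fun x => Subtype.ext (hf x x.2)⟩, fun x y => h x x.2 y y.2⟩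

theorem selfDual_pair (H : Dgraph V) (x y : V) : SelfDual (H.ind {x, y}) := by
  classical
  refine selfDual_of_involutive (Equiv.swap x y) ?_ (by simp) ?_
  · rintro v (rfl | rfl) <;> simp
  · rintro v (rfl | rfl) w (rfl | rfl) <;> simp [H.irrefl]

theorem selfDual_triple_of_swap {H : Dgraph V} {x y z : V} (hxz : x ≠ z) (hyz : y ≠ z)
    (h : H.Arc x z ↔ H.Arc z y) (h' : H.Arc z x ↔ H.Arc y z) :
    SelfDual (H.ind {x, y, z}) := by
  classical
  have hz : Equiv.swap x y z = z := Equiv.swap_apply_of_ne_of_ne hxz.symm hyz.symm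
  refine selfDual_of_involutive (Equiv.swap x y) ?_ (by simp) ?_
  · rintro v (rfl | rfl | rfl) <;> simp [hz]
  · rintro v (rfl | rfl | rfl) w (rfl | rfl | rfl) <;> simp [H.irrefl, hz, h, h']

theorem selfDual_triple {H : Dgraph V} (hp : PeakFree H.Arc)
    (hp' : PeakFree fun x y => H.Arc y x) (hf : FlagFree H.Arc) {x y z : V} (hxy : x ≠ y)
    (hxz : x ≠ z) (hyz : y ≠ z) : SelfDual (H.ind {x, y, z}) := by
  by_cases s1 : (H.Arc x z ↔ H.Arc z y) ∧ (H.Arc z x ↔ H.Arc y z)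
  · exact selfDual_triple_of_swap hxz hyz s1.1 s1.2
  by_cases s2 : (H.Arc x y ↔ H.Arc y z) ∧ (H.Arc y x ↔ H.Arc z y)
  · have := selfDual_triple_of_swap hxy hyz.symm s2.1 s2.2
    rwa [Set.pair_comm z y] at this
  by_cases s3 : (H.Arc y x ↔ H.Arc x z) ∧ (H.Arc x y ↔ H.Arc z x)
  · have := selfDual_triple_of_swap hxy.symm hxz.symm s3.1 s3.2
    rwa [Set.pair_comm z x, Set.insert_comm y x] at this
  have p1 := hp x y z hyz
  have p2 := hp y x z hxz
  have p3 := hp z x y hxy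
  have p4 := hp' x y z hyz
  have p5 := hp' y x z hxz
  have p6 := hp' z x y hxy
  have f1 := hf x y z
  have f2 := hf x z y
  have f3 := hf y x z
  have f4 := hf y z x
  have f5 := hf z x y
  have f6 := hf z y x
  have n : (H.Arc x y ↔ H.Arc y x) ∧ (H.Arc x z ↔ H.Arc z x) ∧ (H.Arc y z ↔ H.Arc z y) := by
    clear hp hp' hf
    grind
  refine selfDual_of_involutive id (fun _ h => h) (fun _ _ => rfl) ?_
  rintro v (rfl | rfl | rfl) w (rfl | rfl | rfl) <;> simp [H.irrefl, n]

theorem selfDual_of_ncard_le_three {H : Dgraph V} (hp : PeakFree H.Arc)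
    (hp' : PeakFree fun x y => H.Arc y x) (hf : FlagFree H.Arc) {X : Set V} (hX : X.Finite)
    (hc : X.ncard ≤ 3) : SelfDual (H.ind X) := by
  obtain h | h | h | h : X.ncard = 0 ∨ X.ncard = 1 ∨ X.ncard = 2 ∨ X.ncard = 3 := by omega
  · obtain rfl := (Set.ncard_eq_zero hX).1 h
    exact selfDual_of_involutive id (by simp) (by simp) (by simp)
  · obtain ⟨x, rfl⟩ := Set.ncard_eq_one.1 h
    rw [← Set.pair_eq_singleton]
    exact H.selfDual_pair x x
  · obtain ⟨x, y, -, rfl⟩ := Set.ncard_eq_two.1 h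
    exact H.selfDual_pair x y
  · obtain ⟨x, y, z, hxy, hxz, hyz, rfl⟩ := Set.ncard_eq_three.1 h
    exact selfDual_triple hp hp' hf hxy hxz hyz

theorem Hemi.iso_of_selfDual {W : Type v} {H : Dgraph V} {H' : Dgraph W} (h : Hemi H H')
    (hs : SelfDual H) : Iso H H' :=
  h.elim id fun h => Iso.trans hs h

theorem KHemi.kHypo_two {H H' : Dgraph V} (h : KHemi 2 H H') : KHypo 2 H H' := by
  intro X hX hc
  obtain ⟨x, y, -, rfl⟩ := Set.ncard_eq_two.1 hc
  exact (h _ hX hc).iso_of_selfDual (H.selfDual_pair x y)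

/-- The case of a single difference class. -/
theorem leHypo_iff_of_connected {H H' : Dgraph V} {k : ℕ} (hk : 3 ≤ k) (hh : LeHemi 6 H H')
    (x₀ : V) (root : ∀ y, Relation.ReflTransGen (DiffStep H H') x₀ y) :
    LeHypo k H H' ↔ (k : ℕ∞) + 1 ≤ Cdual H := by
  have h2 : KHypo 2 H H' := KHemi.kHypo_two (hh 2 (by norm_num) (by norm_num))
  have conn : ∀ x y, Relation.ReflTransGen (DiffStep H H') x y := by
    have : Std.Symm (DiffStep H H') := ⟨fun x y => by
      have p := h2.pair x y
      unfold DiffStep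
      tauto⟩
    exact fun x y => (Relation.ReflTransGen.stdSymm.symm _ _ (root x)).trans (root y)
  rw [natCast_add_one_le_cdual_iff]
  constructor
  · intro h X hX hc
    have h3 : KHypo 3 H H' := h 3 (by norm_num) hk
    by_cases hc3 : X.ncard ≤ 3
    · have hr := rev_of_hypo h2 h3
      exact selfDual_of_ncard_le_three (hr.peakFree conn) (hr.flip.peakFree conn)
        (hr.flagFree conn fun a b c x h1 h5 h6 h7 h8 h9 h10 h11 h12 h13 =>
          flag_cone h2 (hh 4 (by norm_num) (by norm_num)) h1 h5 h6 h7 h8 h9 h10 h11 h12 h13)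
        hX hc3
    · exact Iso.trans (h _ (by omega) hc X hX rfl)
        (iso_dual_of_connected h2 h3 (h 4 (by norm_num) (by omega)) conn X hX).symm
  · intro h
    have low : ∀ j, 1 ≤ j → j ≤ 6 → j ≤ k → KHypo j H H' := fun j h1 h6 hj X hX hc =>
      (hh j h1 h6 X hX hc).iso_of_selfDual (h X hX (hc.trans_le hj))
    intro j h1 hj
    by_cases h6 : j ≤ 6
    · exact low j h1 h6 hj
    · exact fun X hX hc => Iso.trans (h X hX (hc.trans_le hj))
        (iso_dual_of_connected h2 (low 3 (by norm_num) (by norm_num) hk)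
          (low 4 (by norm_num) (by norm_num) (by omega)) conn X hX)

theorem ind_ind_iso (G : Dgraph V) (C : Set V) (X : Set C) :
    Iso ((G.ind C).ind X) (G.ind (Subtype.val '' X)) :=
  ⟨Equiv.Set.image _ X Subtype.val_injective, fun _ _ => Iff.rfl⟩

theorem Hemi.congr {W V' W' : Type*} {G : Dgraph V} {H : Dgraph W} {G' : Dgraph V'}
    {H' : Dgraph W'} (h : Hemi G H) (hG : Iso G G') (hH : Iso H H') : Hemi G' H' :=
  h.imp (fun h => (hG.symm.trans h).trans hH) fun h => (hG.dual.symm.trans h).trans hH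

theorem KHemi.ind {G G' : Dgraph V} {k : ℕ} (h : KHemi k G G') (C : Set V) :
    KHemi k (G.ind C) (G'.ind C) := fun X hX hc =>
  (h (Subtype.val '' X) (hX.image _)
    (by rw [Set.ncard_image_of_injective X Subtype.val_injective, hc])).congr
    (G.ind_ind_iso C X).symm (G'.ind_ind_iso C X).symm

theorem DiffClass.exists_root {G G' : Dgraph V} {C : Set V} (hC : DiffClass G G' C) :
    ∃ x : C, ∀ y : C, Relation.ReflTransGen (DiffStep (G.ind C) (G'.ind C)) x y := by
  obtain ⟨x, rfl⟩ := hC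
  have key : ∀ y, Relation.ReflTransGen (DiffStep G G') x y →
      ∃ hy : DiffRel G G' x y, Relation.ReflTransGen
        (DiffStep (G.ind {y | DiffRel G G' x y}) (G'.ind {y | DiffRel G G' x y}))
        ⟨x, Or.inl rfl⟩ ⟨y, hy⟩ := by
    intro y hy
    induction hy with
    | refl => exact ⟨Or.inl rfl, .refl⟩
    | @tail b c hb hbc ih =>
      obtain ⟨hb', ih⟩ := ih
      exact ⟨Or.inr (Relation.TransGen.tail' hb hbc), ih.tail hbc⟩
  refine ⟨⟨x, Or.inl rfl⟩, fun y => ?_⟩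
  obtain ⟨y, hy⟩ := y
  exact (key y (hy.elim (fun e => e ▸ .refl) Relation.TransGen.to_reflTransGen)).2

end Dgraph

open Dgraph
/-- Corollary CP: for (≤6)-hemimorphic digraphs and a difference class C, G[C] and
G'[C] are (≤k)-hypomorphic iff C_dual(G[C]) ≥ k+1. -/
theorem corollary_CP {V : Type u} (k : ℕ) (hk : 3 ≤ k) (G G' : Dgraph V)
    (hhemi : Dgraph.LeHemi 6 G G') (C : Set V) (hC : Dgraph.DiffClass G G' C) :
    Dgraph.LeHypo k (G.ind C) (G'.ind C) ↔ (k : ℕ∞) + 1 ≤ Dgraph.Cdual (G.ind C) := by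
  obtain ⟨x, hx⟩ := hC.exists_root
  exact leHypo_iff_of_connected hk (fun j h1 h6 => KHemi.ind (hhemi j h1 h6) C) x hx
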